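/- arXiv:2305.14664 — 2 statements merged into one kernel-verified Lean document; each statement's English description precedes it below -/
import Mathlib

section
/- For every complex number z, the function x ↦ Φ(x)e^{ixz} is integrable on ℝ, and the function ψ_R : ℂ → ℂ defined by ψ_R(z) = ∫_{−∞}^{∞} Φ(x) e^{ixz} dx is entire (complex differentiable at every point of ℂ). -/
open Real MeasureTheory Complex

/-- The Fourier kernel of the Riemann Xi function:
`Φ(x) = Σ_{n=1}^∞ (4π²n⁴e^{9x/2} − 6πn²e^{5x/2}) exp(−πn²e^{2x})`. -/
noncomputable def RiemannPhi (x : ℝ) : ℝ :=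
  ∑' n : ℕ, (4 * π ^ 2 * ((n : ℝ) + 1) ^ 4 * Real.exp (9 * x / 2)
      - 6 * π * ((n : ℝ) + 1) ^ 2 * Real.exp (5 * x / 2))
    * Real.exp (-π * ((n : ℝ) + 1) ^ 2 * Real.exp (2 * x))

noncomputable def thG (k : ℕ) (t : ℝ) : ℝ :=
  ∑' n : ℕ, ((n : ℝ) + 1) ^ k * Real.exp (-π * ((n : ℝ) + 1) ^ 2 * t)

lemma thG_summable (k : ℕ) {t : ℝ} (ht : 0 < t) :
    Summable (fun n : ℕ => ((n : ℝ) + 1) ^ k * Real.exp (-π * ((n : ℝ) + 1) ^ 2 * t)) :=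
  HurwitzKernelBounds.summable_f_nat k 1 ht

lemma thG_hasDerivAt (k : ℕ) {t : ℝ} (ht : 0 < t) :
    HasDerivAt (thG k) (-π * thG (k + 2) t) t := by
  have h2 : (0 : ℝ) < t / 2 := by positivity
  have key := hasDerivAt_tsum_of_isPreconnected (𝕜 := ℝ)
    (g := fun (n : ℕ) (t : ℝ) => ((n : ℝ) + 1) ^ k * Real.exp (-π * ((n : ℝ) + 1) ^ 2 * t))
    (g' := fun (n : ℕ) (t : ℝ) =>
      -π * (((n : ℝ) + 1) ^ (k + 2) * Real.exp (-π * ((n : ℝ) + 1) ^ 2 * t)))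
    (u := fun n : ℕ =>
      π * (((n : ℝ) + 1) ^ (k + 2) * Real.exp (-π * ((n : ℝ) + 1) ^ 2 * (t / 2))))
    (t := Set.Ioi (t / 2)) (y₀ := t) (y := t)
    ((thG_summable (k + 2) h2).mul_left π) isOpen_Ioi isPreconnected_Ioi
    (by
      intro n y _
      have h := (((hasDerivAt_id y).const_mul (-π * ((n : ℝ) + 1) ^ 2)).exp).const_mul
        (((n : ℝ) + 1) ^ k)
      convert! h using 1
      simp only [id]
      ring)
    (by
      intro n y hy
      have hy' : t / 2 < y := hy
      rw [norm_mul, norm_neg, Real.norm_of_nonneg pi_pos.le, Real.norm_of_nonneg (by positivity)]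
      have : π * ((n : ℝ) + 1) ^ 2 * (t / 2) ≤ π * ((n : ℝ) + 1) ^ 2 * y := by gcongr
      gcongr π * (_ * Real.exp ?_)
      linarith)
    (by simpa using ht) (thG_summable k ht) (by simpa using ht)
  rw [tsum_mul_left] at key
  exact key

lemma thG_nonneg (k : ℕ) (t : ℝ) : 0 ≤ thG k t := tsum_nonneg fun n => by positivity

lemma thG_bound (k : ℕ) {t : ℝ} (ht : 1 ≤ t) :
    thG k t ≤ Real.exp (-π * (t - 1)) * thG k 1 := by
  unfold thG
  rw [← tsum_mul_left]
  refine Summable.tsum_le_tsum (fun n => ?_) (thG_summable k (by linarith))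
    ((thG_summable k one_pos).mul_left _)
  rw [mul_left_comm, ← Real.exp_add]
  gcongr
  have h1 : (1 : ℝ) ≤ ((n : ℝ) + 1) ^ 2 := by nlinarith [n.cast_nonneg (α := ℝ)]
  have := mul_nonneg pi_pos.le (mul_nonneg (sub_nonneg.2 h1) (sub_nonneg.2 ht))
  linarith

lemma thG_fe {t : ℝ} (ht : 0 < t) :
    1 + 2 * thG 0 t = 1 / t ^ (1 / 2 : ℝ) * (1 + 2 * thG 0 (1 / t)) := by
  have key : ∀ s : ℝ, 0 < s → HurwitzZeta.cosKernel 0 s = 1 + 2 * thG 0 s := by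
    intro s hs
    have h := (HurwitzZeta.hasSum_nat_cosKernel₀ 0 hs).tsum_eq
    simp only [mul_zero, zero_mul, Real.cos_zero, mul_one, QuotientAddGroup.mk_zero] at h
    rw [tsum_mul_left] at h
    simp only [thG, pow_zero, one_mul]
    rw [h]; ring
  have h := HurwitzZeta.evenKernel_functional_equation 0 t
  rw [HurwitzZeta.evenKernel_eq_cosKernel_of_zero, key t ht, key _ (by positivity)] at h
  exact h

noncomputable def thH (x : ℝ) : ℝ := Real.exp (x / 2) * (1 + 2 * thG 0 (Real.exp (2 * x)))

noncomputable def thH' (x : ℝ) : ℝ :=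
  Real.exp (x / 2) * (1 / 2 + thG 0 (Real.exp (2 * x))
    - 4 * π * Real.exp (2 * x) * thG 2 (Real.exp (2 * x)))

lemma thH_even (x : ℝ) : thH (-x) = thH x := by
  unfold thH
  rw [thG_fe (Real.exp_pos (2 * x)), ← Real.exp_mul, one_div, one_div (Real.exp _),
    ← Real.exp_neg, ← Real.exp_neg, ← mul_assoc, ← Real.exp_add]
  congr 2 <;> ring_nf

lemma thGe_hasDerivAt (k : ℕ) (x : ℝ) : HasDerivAt (fun x => thG k (Real.exp (2 * x)))
    (-2 * π * Real.exp (2 * x) * thG (k + 2) (Real.exp (2 * x))) x := by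
  have h1 : HasDerivAt (fun x : ℝ => Real.exp (2 * x)) (Real.exp (2 * x) * (2 * 1)) x :=
    ((hasDerivAt_id x).const_mul 2).exp
  have h := (thG_hasDerivAt k (Real.exp_pos (2 * x))).comp x h1
  convert! h using 1
  ring

lemma exp_half_hasDerivAt (x : ℝ) :
    HasDerivAt (fun x : ℝ => Real.exp (x / 2)) (Real.exp (x / 2) * (1 / 2)) x :=
  ((hasDerivAt_id x).div_const 2).exp

lemma thH_hasDerivAt (x : ℝ) : HasDerivAt thH (thH' x) x := by
  have h := (exp_half_hasDerivAt x).mul (((thGe_hasDerivAt 0 x).const_mul 2).const_add 1)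
  convert! h using 1
  unfold thH'
  ring

lemma phi_eq (x : ℝ) : RiemannPhi x =
    4 * π ^ 2 * Real.exp (9 * x / 2) * thG 4 (Real.exp (2 * x))
      - 6 * π * Real.exp (5 * x / 2) * thG 2 (Real.exp (2 * x)) := by
  unfold RiemannPhi thG
  rw [← tsum_mul_left, ← tsum_mul_left, ← Summable.tsum_sub
    ((thG_summable 4 (Real.exp_pos _)).mul_left _) ((thG_summable 2 (Real.exp_pos _)).mul_left _)]
  congr 1
  ext n
  ring

lemma thH'_hasDerivAt (x : ℝ) : HasDerivAt thH' (2 * RiemannPhi x + thH x / 4) x := by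
  have h1 : HasDerivAt (fun x : ℝ => Real.exp (2 * x)) (Real.exp (2 * x) * (2 * 1)) x :=
    ((hasDerivAt_id x).const_mul 2).exp
  have h := (exp_half_hasDerivAt x).mul (((thGe_hasDerivAt 0 x).const_add (1 / 2)).sub
    ((h1.const_mul (4 * π)).mul (thGe_hasDerivAt 2 x)))
  convert! h using 1
  rw [phi_eq]
  unfold thH
  have e9 : Real.exp (9 * x / 2) = Real.exp (x / 2) * Real.exp (2 * x) ^ 2 := by
    rw [← Real.exp_nat_mul, ← Real.exp_add]; congr 1; push_cast; ring
  have e5 : Real.exp (5 * x / 2) = Real.exp (x / 2) * Real.exp (2 * x) := by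
    rw [← Real.exp_add]; congr 1; ring
  rw [e9, e5]
  simp only [Pi.mul_apply, Pi.sub_apply]
  ring

lemma thH'_odd (x : ℝ) : thH' (-x) = -thH' x := by
  have h := (thH_hasDerivAt (-x)).comp x (hasDerivAt_neg x)
  have e : thH ∘ Neg.neg = thH := funext thH_even
  have h2 := (e ▸ h : HasDerivAt thH _ x).unique (thH_hasDerivAt x)
  linarith

lemma phi_even (x : ℝ) : RiemannPhi (-x) = RiemannPhi x := by
  have h := (thH'_hasDerivAt (-x)).comp x (hasDerivAt_neg x)
  have e : thH' ∘ Neg.neg = fun x => -thH' x := funext thH'_odd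
  have h2 := (e ▸ h : HasDerivAt (fun x => -thH' x) _ x).unique (thH'_hasDerivAt x).neg
  rw [thH_even] at h2
  linarith

lemma phi_cont : Continuous RiemannPhi := by
  have e : RiemannPhi = fun x => 4 * π ^ 2 * Real.exp (9 * x / 2) * thG 4 (Real.exp (2 * x))
      - 6 * π * Real.exp (5 * x / 2) * thG 2 (Real.exp (2 * x)) := funext phi_eq
  have h : ∀ k, Continuous (fun x => thG k (Real.exp (2 * x))) := fun k =>
    continuous_iff_continuousAt.2 fun x => (thGe_hasDerivAt k x).continuousAt
  have h4 := h 4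
  have h2 := h 2
  rw [e]
  fun_prop

lemma phi_bound : ∃ C : ℝ, 0 ≤ C ∧ ∀ x, |RiemannPhi x| ≤ C * Real.exp (-x ^ 2) := by
  set A := 4 * π ^ 2 * thG 4 1 + 6 * π * thG 2 1 with hA
  have hG4 := thG_nonneg 4 1
  have hG2 := thG_nonneg 2 1
  have hA0 : 0 ≤ A := by positivity
  have main : ∀ x : ℝ, 0 ≤ x → |RiemannPhi x| ≤ (A * Real.exp 2) * Real.exp (-x ^ 2) := by
    intro x hx
    have ht : 1 ≤ Real.exp (2 * x) := Real.one_le_exp (by positivity)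
    have b4 := thG_bound 4 ht
    have b2 := thG_bound 2 ht
    have n4 := thG_nonneg 4 (Real.exp (2 * x))
    have n2 := thG_nonneg 2 (Real.exp (2 * x))
    have e59 : Real.exp (5 * x / 2) ≤ Real.exp (9 * x / 2) := by gcongr; linarith
    have hq : 1 + 2 * x + (2 * x) ^ 2 / 2 ≤ Real.exp (2 * x) :=
      Real.quadratic_le_exp_of_nonneg (by positivity)
    have hp := Real.pi_gt_three
    have hexp : Real.exp (9 * x / 2) * Real.exp (-π * (Real.exp (2 * x) - 1))
        ≤ Real.exp 2 * Real.exp (-x ^ 2) := by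
      rw [← Real.exp_add, ← Real.exp_add]
      refine Real.exp_le_exp.2 ?_
      nlinarith [mul_nonneg (sub_nonneg.2 hp.le) (by linarith [sq_nonneg x] :
        0 ≤ Real.exp (2 * x) - 1), sq_nonneg x]
    rw [phi_eq]
    set E := Real.exp (-π * (Real.exp (2 * x) - 1))
    calc |4 * π ^ 2 * Real.exp (9 * x / 2) * thG 4 (Real.exp (2 * x))
      - 6 * π * Real.exp (5 * x / 2) * thG 2 (Real.exp (2 * x))|
        ≤ |4 * π ^ 2 * Real.exp (9 * x / 2) * thG 4 (Real.exp (2 * x))|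
          + |6 * π * Real.exp (5 * x / 2) * thG 2 (Real.exp (2 * x))| := abs_sub _ _
      _ = 4 * π ^ 2 * Real.exp (9 * x / 2) * thG 4 (Real.exp (2 * x))
          + 6 * π * Real.exp (5 * x / 2) * thG 2 (Real.exp (2 * x)) := by
          rw [abs_of_nonneg (by positivity), abs_of_nonneg (by positivity)]
      _ ≤ 4 * π ^ 2 * Real.exp (9 * x / 2) * (E * thG 4 1)
          + 6 * π * Real.exp (9 * x / 2) * (E * thG 2 1) := by gcongr
      _ = A * (Real.exp (9 * x / 2) * E) := by rw [hA]; ring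
      _ ≤ A * (Real.exp 2 * Real.exp (-x ^ 2)) := by gcongr
      _ = _ := by ring
  refine ⟨A * Real.exp 2, by positivity, fun x => ?_⟩
  rcases le_total 0 x with h | h
  · exact main x h
  · have := main (-x) (by linarith)
    rwa [phi_even, neg_sq] at this

lemma norm_phi_exp {C : ℝ} (hC0 : 0 ≤ C) (hC : ∀ x, |RiemannPhi x| ≤ C * Real.exp (-x ^ 2))
    {R : ℝ} {z : ℂ} (hz : ‖z‖ + 1 ≤ R) (x : ℝ) :
    Real.exp |x| * ‖(RiemannPhi x : ℂ) * Complex.exp (Complex.I * x * z)‖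
      ≤ C * Real.exp (R ^ 2 / 2) * Real.exp (-(1 / 2) * x ^ 2) := by
  have h1 : ‖Complex.exp (Complex.I * x * z)‖ ≤ Real.exp (|x| * ‖z‖) := by
    refine (Complex.norm_exp_le_exp_norm _).trans (le_of_eq ?_)
    simp
  rw [norm_mul, Complex.norm_real, Real.norm_eq_abs]
  calc _ ≤ Real.exp |x| * ((C * Real.exp (-x ^ 2)) * Real.exp (|x| * ‖z‖)) := by
        gcongr
        exact hC x
    _ = C * Real.exp (|x| + -x ^ 2 + |x| * ‖z‖) := by
        rw [Real.exp_add, Real.exp_add]; ring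
    _ ≤ C * Real.exp (R ^ 2 / 2 + -(1 / 2) * x ^ 2) := by
        refine mul_le_mul_of_nonneg_left (Real.exp_le_exp.2 ?_) hC0
        nlinarith [sq_nonneg (R - |x|), sq_abs x, mul_le_mul_of_nonneg_left hz (abs_nonneg x)]
    _ = _ := by rw [Real.exp_add]; ring

theorem psiR_integrable_and_entire :
    (∀ z : ℂ, Integrable (fun x : ℝ => (RiemannPhi x : ℂ) * Complex.exp (Complex.I * x * z))) ∧
    (∀ z : ℂ, DifferentiableAt ℂ
      (fun z : ℂ => ∫ x : ℝ, (RiemannPhi x : ℂ) * Complex.exp (Complex.I * x * z)) z) := by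
  obtain ⟨C, hC0, hC⟩ := phi_bound
  have hcont : Continuous (fun x => (RiemannPhi x : ℂ)) :=
    Complex.continuous_ofReal.comp phi_cont
  have hb : ∀ R : ℝ, Integrable
      (fun x : ℝ => C * Real.exp (R ^ 2 / 2) * Real.exp (-(1 / 2) * x ^ 2)) := fun R =>
    (integrable_exp_neg_mul_sq (by norm_num)).const_mul _
  have hF : ∀ z : ℂ, Continuous
      (fun x : ℝ => (RiemannPhi x : ℂ) * Complex.exp (Complex.I * x * z)) := by
    intro z; fun_prop
  have hint : ∀ z : ℂ, Integrable
      (fun x : ℝ => (RiemannPhi x : ℂ) * Complex.exp (Complex.I * x * z)) := by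
    intro z
    refine (hb (‖z‖ + 1)).mono' (hF z).aestronglyMeasurable (Filter.Eventually.of_forall fun x => ?_)
    refine le_trans ?_ (norm_phi_exp hC0 hC le_rfl x)
    exact le_mul_of_one_le_left (norm_nonneg _) (Real.one_le_exp (abs_nonneg x))
  refine ⟨hint, fun z => ?_⟩
  refine (hasDerivAt_integral_of_dominated_loc_of_deriv_le (𝕜 := ℂ) (μ := volume)
    (F := fun (z : ℂ) (x : ℝ) => (RiemannPhi x : ℂ) * Complex.exp (Complex.I * x * z))
    (F' := fun (z : ℂ) (x : ℝ) =>
      (Complex.I * x) * ((RiemannPhi x : ℂ) * Complex.exp (Complex.I * x * z)))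
    (Metric.ball_mem_nhds z one_pos)
    (Filter.Eventually.of_forall fun w => (hF w).aestronglyMeasurable) (hint z)
    ?_ (Filter.Eventually.of_forall fun x w hw => ?_) (hb (‖z‖ + 2))
    (Filter.Eventually.of_forall fun x w _ => ?_)).2.differentiableAt
  · have := hF z
    exact Continuous.aestronglyMeasurable (by fun_prop)
  · have hw' : ‖w‖ + 1 ≤ ‖z‖ + 2 := by
      have h1 : ‖w - z‖ < 1 := by simpa [dist_eq_norm] using hw
      have := norm_le_norm_add_norm_sub' w z
      linarith
    refine le_trans ?_ (norm_phi_exp hC0 hC hw' x)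
    rw [norm_mul]
    gcongr
    simp only [norm_mul, Complex.norm_I, one_mul, Complex.norm_real, Real.norm_eq_abs]
    linarith [Real.add_one_le_exp |x|]
  · have h := (((hasDerivAt_id w).const_mul (Complex.I * x)).cexp).const_mul (RiemannPhi x : ℂ)
    convert! h using 1
    simp only [id]
    ring
end

section
/- Exponential generating function of the two matrix model polynomials: let V be a polynomial with complex coefficients and g a nonzero complex number, and for each natural number N define Q_N(y) = (−g)^N · (d^N/da^N)[exp(−(V(a+1) − a·y)/g)] evaluated at a = 0. Then for all complex numbers t and y, the series Σ_{N=0}^∞ Q_N(y) t^N / N! converges with sum exp(−V(1 − g t)/g − t·y). -/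
theorem two_matrix_model_generating_function (V : Polynomial ℂ) (g : ℂ) (hg : g ≠ 0)
    (Q : ℕ → ℂ → ℂ)
    (hQ : ∀ N : ℕ, ∀ y : ℂ, Q N y = (-g) ^ N *
      iteratedDeriv N (fun a : ℂ => Complex.exp (-(V.eval (a + 1) - a * y) / g)) 0)
    (t y : ℂ) :
    HasSum (fun N : ℕ => Q N y * t ^ N / (N.factorial : ℂ))
      (Complex.exp (-V.eval (1 - g * t) / g - t * y)) := by
  have hf : Differentiable ℂ
      (fun a : ℂ => Complex.exp (-(V.eval (a + 1) - a * y) / g)) := by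
    have hV : Differentiable ℂ (fun a : ℂ => V.eval (a + 1)) :=
      V.differentiable.comp (differentiable_id.add_const 1)
    fun_prop
  have h := Complex.hasSum_taylorSeries_of_entire hf 0 (-g * t)
  have e : Complex.exp (-V.eval (1 - g * t) / g - t * y) =
      (fun a : ℂ => Complex.exp (-(V.eval (a + 1) - a * y) / g)) (-g * t) := by
    have h1 : -g * t + 1 = 1 - g * t := by ring
    simp only [h1]
    congr 1
    field_simp
    ring
  rw [e]
  have hterm : (fun N : ℕ => Q N y * t ^ N / (N.factorial : ℂ)) =
      fun n : ℕ => (n.factorial : ℂ)⁻¹ • (-g * t - 0) ^ n • iteratedDeriv n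
        (fun a : ℂ => Complex.exp (-(V.eval (a + 1) - a * y) / g)) 0 := by
    funext N
    rw [hQ, sub_zero, mul_pow, smul_eq_mul, smul_eq_mul, div_eq_mul_inv]
    ring
  rw [hterm]
  exact h
end
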